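/- Let L > 0, let φ₁, …, φₙ ∈ ℝ^d with ‖φⱼ‖₂ ≤ 1 for all j, let λ > 0, and let θ₁, θ₂ ∈ ℝ^d with ‖θ₁‖₂ ≤ L and ‖θ₂‖₂ ≤ L. Then G(θ₁, θ₂) ⪰ (1 + 2L)⁻¹·H(θ₁) and G(θ₁, θ₂) ⪰ (1 + 2L)⁻¹·H(θ₂), where G(θ₁, θ₂) := Σⱼ α(φⱼ, θ₁, θ₂)·φⱼφⱼᵀ + λ·I_d and H(θ) := Σⱼ ℓ̇(φⱼᵀθ)·φⱼφⱼᵀ + λ·I_d. -/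

import Mathlib

open Matrix

/-- The sigmoid (logistic) function `ℓ(x) = (1 + e^{−x})⁻¹`. -/
noncomputable def sigmoid (x : ℝ) : ℝ := (1 + Real.exp (-x))⁻¹

/-- `α(x, θ₁, θ₂) := ∫₀¹ ℓ̇(v·xᵀθ₂ + (1−v)·xᵀθ₁) dv`. -/
noncomputable def alphaCoeff {d : ℕ} (x θ₁ θ₂ : Fin d → ℝ) : ℝ :=
  ∫ v in (0:ℝ)..1, deriv sigmoid (v * (x ⬝ᵥ θ₂) + (1 - v) * (x ⬝ᵥ θ₁))

/-- `G(θ₁, θ₂) := Σⱼ α(φⱼ, θ₁, θ₂)·φⱼφⱼᵀ + λ·I`. -/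
noncomputable def Gmat {d n : ℕ} (φ : Fin n → Fin d → ℝ) (lam : ℝ)
    (θ₁ θ₂ : Fin d → ℝ) : Matrix (Fin d) (Fin d) ℝ :=
  (∑ j, alphaCoeff (φ j) θ₁ θ₂ • Matrix.vecMulVec (φ j) (φ j)) + lam • 1

/-- `H(θ) := Σⱼ ℓ̇(φⱼᵀθ)·φⱼφⱼᵀ + λ·I`. -/
noncomputable def Hmat {d n : ℕ} (φ : Fin n → Fin d → ℝ) (lam : ℝ)
    (θ : Fin d → ℝ) : Matrix (Fin d) (Fin d) ℝ :=
  (∑ j, deriv sigmoid (φ j ⬝ᵥ θ) • Matrix.vecMulVec (φ j) (φ j)) + lam • 1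

theorem deriv_sigmoid (x : ℝ) :
    deriv sigmoid x = (Real.exp x + 2 + Real.exp (-x))⁻¹ := by
  have hE : HasDerivAt (fun y : ℝ => 1 + Real.exp (-y)) (Real.exp (-x) * -1) x :=
    ((hasDerivAt_neg x).exp).const_add 1
  have hpos : (1 + Real.exp (-x)) ≠ 0 := by positivity
  have h : deriv sigmoid x = _ := (hE.inv hpos).deriv
  rw [h]
  have hx : Real.exp x * Real.exp (-x) = 1 := by rw [← Real.exp_add]; simp
  have hpos' : Real.exp x + 2 + Real.exp (-x) ≠ 0 := by positivity
  rw [inv_eq_one_div, div_eq_div_iff (by positivity) hpos']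
  linear_combination hx

theorem continuous_deriv_sigmoid : Continuous (deriv sigmoid) := by
  rw [funext deriv_sigmoid]
  exact Continuous.inv₀ (by fun_prop) fun x => by positivity

theorem deriv_sigmoid_nonneg (x : ℝ) : 0 ≤ deriv sigmoid x := by
  rw [deriv_sigmoid]
  positivity

/-- Self-concordance of the logistic function, in integrated form. -/
theorem deriv_sigmoid_mul_exp_le {z w r : ℝ} (h : |z - w| ≤ r) :
    deriv sigmoid w * Real.exp (-r) ≤ deriv sigmoid z := by
  obtain ⟨h₁, h₂⟩ := abs_le.mp h
  rw [deriv_sigmoid, deriv_sigmoid, Real.exp_neg r, ← mul_inv]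
  refine inv_anti₀ (by positivity) ?_
  have e₁ : Real.exp z ≤ Real.exp w * Real.exp r := by
    rw [← Real.exp_add]
    exact Real.exp_le_exp.mpr (by linarith)
  have e₂ : Real.exp (-z) ≤ Real.exp (-w) * Real.exp r := by
    rw [← Real.exp_add]
    exact Real.exp_le_exp.mpr (by linarith)
  have e₃ : 1 ≤ Real.exp r := Real.one_le_exp ((abs_nonneg _).trans h)
  linarith

theorem inv_one_add_le_integral_exp {M : ℝ} (hM : 0 < M) :
    (1 + M)⁻¹ ≤ ∫ v in (0:ℝ)..1, Real.exp (-(v * M)) := by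
  have hd (v : ℝ) : HasDerivAt (fun v : ℝ => -(Real.exp (-(v * M)) / M))
      (Real.exp (-(v * M))) v := by
    have h := ((((hasDerivAt_id v).mul_const M).neg.exp).div_const M).neg
    refine h.congr_deriv ?_
    change -(Real.exp (-(v * M)) * -(1 * M) / M) = Real.exp (-(v * M))
    field_simp
  rw [intervalIntegral.integral_eq_sub_of_hasDerivAt (fun v _ => hd v)
    (Continuous.intervalIntegrable (by fun_prop) _ _)]
  have hx : Real.exp M * Real.exp (-M) = 1 := by rw [← Real.exp_add]; simp
  have hle : (1 + M) * Real.exp (-M) ≤ 1 := by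
    rw [← hx]
    exact mul_le_mul_of_nonneg_right (by linarith [Real.add_one_le_exp M]) (Real.exp_pos _).le
  have heq : -(Real.exp (-(1 * M)) / M) - -(Real.exp (-(0 * M)) / M)
      = (1 - Real.exp (-M)) / M := by
    simp only [one_mul, zero_mul, neg_zero, Real.exp_zero]
    ring
  rw [heq, inv_eq_one_div, div_le_div_iff₀ (by positivity) hM]
  linarith

theorem inv_mul_deriv_sigmoid_le_integral {M a b : ℝ} (hM : 0 < M) (hab : |b - a| ≤ M) :
    (1 + M)⁻¹ * deriv sigmoid a ≤ ∫ v in (0:ℝ)..1, deriv sigmoid (v * b + (1 - v) * a) := by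
  calc (1 + M)⁻¹ * deriv sigmoid a
      ≤ (∫ v in (0:ℝ)..1, Real.exp (-(v * M))) * deriv sigmoid a :=
        mul_le_mul_of_nonneg_right (inv_one_add_le_integral_exp hM) (deriv_sigmoid_nonneg a)
    _ = ∫ v in (0:ℝ)..1, deriv sigmoid a * Real.exp (-(v * M)) := by
        rw [intervalIntegral.integral_const_mul, mul_comm]
    _ ≤ _ := by
        refine intervalIntegral.integral_mono_on zero_le_one
          (Continuous.intervalIntegrable (by fun_prop) _ _)
          ((continuous_deriv_sigmoid.comp (by fun_prop)).intervalIntegrable _ _) ?_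
        intro v hv
        apply deriv_sigmoid_mul_exp_le
        rw [show v * b + (1 - v) * a - a = v * (b - a) by ring, abs_mul, abs_of_nonneg hv.1]
        exact mul_le_mul_of_nonneg_left hab hv.1

theorem alphaCoeff_comm {d : ℕ} (x θ₁ θ₂ : Fin d → ℝ) :
    alphaCoeff x θ₁ θ₂ = alphaCoeff x θ₂ θ₁ := by
  have h := intervalIntegral.integral_comp_sub_left (a := 0) (b := 1)
    (fun v : ℝ => deriv sigmoid (v * (x ⬝ᵥ θ₂) + (1 - v) * (x ⬝ᵥ θ₁))) 1
  simp only [sub_self, sub_zero, sub_sub_cancel] at h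
  unfold alphaCoeff
  rw [← h]
  simp only [add_comm]

theorem Gmat_comm {d n : ℕ} (φ : Fin n → Fin d → ℝ) (lam : ℝ) (θ₁ θ₂ : Fin d → ℝ) :
    Gmat φ lam θ₁ θ₂ = Gmat φ lam θ₂ θ₁ := by
  simp only [Gmat, alphaCoeff_comm _ θ₁ θ₂]

theorem abs_dotProduct_le_of_sqrt_le {d : ℕ} {L : ℝ} {x θ : Fin d → ℝ}
    (hx : Real.sqrt (x ⬝ᵥ x) ≤ 1) (hθ : Real.sqrt (θ ⬝ᵥ θ) ≤ L) : |x ⬝ᵥ θ| ≤ L := by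
  have hcs : (x ⬝ᵥ θ) ^ 2 ≤ (x ⬝ᵥ x) * (θ ⬝ᵥ θ) := by
    simpa only [dotProduct, sq] using Finset.sum_mul_sq_le_sq_mul_sq Finset.univ x θ
  have hxx : 0 ≤ x ⬝ᵥ x := Finset.sum_nonneg fun i _ => mul_self_nonneg (x i)
  calc |x ⬝ᵥ θ| ≤ Real.sqrt ((x ⬝ᵥ x) * (θ ⬝ᵥ θ)) := Real.abs_le_sqrt hcs
    _ = Real.sqrt (x ⬝ᵥ x) * Real.sqrt (θ ⬝ᵥ θ) := Real.sqrt_mul hxx _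
    _ ≤ 1 * L := mul_le_mul hx hθ (Real.sqrt_nonneg _) zero_le_one
    _ = L := one_mul L

theorem posSemidef_Gmat_sub_smul_Hmat {d n : ℕ} {L : ℝ} (hL : 0 < L)
    {φ : Fin n → Fin d → ℝ} (hφ : ∀ j, Real.sqrt (φ j ⬝ᵥ φ j) ≤ 1)
    {lam : ℝ} (hlam : 0 ≤ lam) {θ₁ θ₂ : Fin d → ℝ}
    (hθ₁ : Real.sqrt (θ₁ ⬝ᵥ θ₁) ≤ L) (hθ₂ : Real.sqrt (θ₂ ⬝ᵥ θ₂) ≤ L) :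
    (Gmat φ lam θ₁ θ₂ - (1 + 2 * L)⁻¹ • Hmat φ lam θ₁).PosSemidef := by
  have hsplit : Gmat φ lam θ₁ θ₂ - (1 + 2 * L)⁻¹ • Hmat φ lam θ₁ =
      (∑ j, (alphaCoeff (φ j) θ₁ θ₂ - (1 + 2 * L)⁻¹ * deriv sigmoid (φ j ⬝ᵥ θ₁)) •
        Matrix.vecMulVec (φ j) (φ j)) + (lam - (1 + 2 * L)⁻¹ * lam) • 1 := by
    simp only [Gmat, Hmat, sub_smul, Finset.sum_sub_distrib, mul_smul, smul_add, Finset.smul_sum]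
    abel
  rw [hsplit]
  refine (Matrix.posSemidef_sum _ fun j _ => ?_).add (Matrix.PosSemidef.one.smul ?_)
  · refine Matrix.PosSemidef.smul ?_ (sub_nonneg.mpr ?_)
    · simpa using Matrix.posSemidef_vecMulVec_self_star (φ j)
    · refine inv_mul_deriv_sigmoid_le_integral (by positivity) ?_
      have h₁ := abs_dotProduct_le_of_sqrt_le (hφ j) hθ₁
      have h₂ := abs_dotProduct_le_of_sqrt_le (hφ j) hθ₂
      linarith [abs_sub (φ j ⬝ᵥ θ₂) (φ j ⬝ᵥ θ₁)]
  · have : (1 + 2 * L)⁻¹ ≤ 1 := inv_le_one_of_one_le₀ (by linarith)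
    exact sub_nonneg.mpr (mul_le_of_le_one_left hlam this)

/-- With `‖φⱼ‖₂ ≤ 1` and `‖θ₁‖₂, ‖θ₂‖₂ ≤ L`,
`G(θ₁,θ₂) ⪰ (1+2L)⁻¹·H(θ₁)` and `G(θ₁,θ₂) ⪰ (1+2L)⁻¹·H(θ₂)`. -/
theorem G_dominates_H {d n : ℕ} (L : ℝ) (hL : 0 < L)
    (φ : Fin n → Fin d → ℝ) (hφ : ∀ j, Real.sqrt (φ j ⬝ᵥ φ j) ≤ 1)
    (lam : ℝ) (hlam : 0 < lam) (θ₁ θ₂ : Fin d → ℝ)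
    (hθ₁ : Real.sqrt (θ₁ ⬝ᵥ θ₁) ≤ L) (hθ₂ : Real.sqrt (θ₂ ⬝ᵥ θ₂) ≤ L) :
    (Gmat φ lam θ₁ θ₂ - (1 + 2 * L)⁻¹ • Hmat φ lam θ₁).PosSemidef ∧
      (Gmat φ lam θ₁ θ₂ - (1 + 2 * L)⁻¹ • Hmat φ lam θ₂).PosSemidef := by
  refine ⟨posSemidef_Gmat_sub_smul_Hmat hL hφ hlam.le hθ₁ hθ₂, ?_⟩
  rw [Gmat_comm]
  exact posSemidef_Gmat_sub_smul_Hmat hL hφ hlam.le hθ₂ hθ₁
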